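/- arXiv:0806.1791 — 4 statements merged into one kernel-verified Lean document; each statement's English description precedes it below -/
import Mathlib

section
/- Let G be a finite group, H a subgroup of G, and g ∈ G. Let C(g) = {xgx⁻¹ : x ∈ G} denote the conjugacy class of g. Then the number of fixed points of g acting on the left coset space G⧸H satisfies |{c ∈ G⧸H : g • c = c}| · |C(g)| · |H| = |C(g) ∩ H| · |G|. -/
/-- The elements moving `b` into `s` are counted by the points of `s` in the orbit of `b`, each
with the multiplicity of the stabilizer. -/
theorem MulAction.card_smul_mem {G X : Type*} [Group G] [MulAction G X] (b : X) (s : Set X) :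
    Nat.card {x : G // x • b ∈ s} =
      Nat.card (stabilizer G b) * Nat.card {y : X // y ∈ orbit G b ∧ y ∈ s} := by
  have h := QuotientGroup.card_preimage_mk (stabilizer G b) (ofQuotientStabilizer G b ⁻¹' s)
  have e : ofQuotientStabilizer G b ⁻¹' s ≃ {y : X // y ∈ orbit G b ∧ y ∈ s} :=
    ((orbitEquivQuotientStabilizer G b).symm.subtypeEquiv fun q ↦ by
      induction q using QuotientGroup.induction_on with
      | H x => rw [orbitEquivQuotientStabilizer_symm_apply]; rfl).trans
      (Equiv.subtypeSubtypeEquivSubtypeInter (· ∈ orbit G b) (· ∈ s))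
  rw [← Nat.card_congr e, ← h]
  rfl

/-- The elements conjugating `g` into `H` form a union of cosets of `H`, one for each fixed
point of `g` on `G ⧸ H`. -/
theorem Subgroup.card_conj_mem_eq_card_mul_card_fixed {G : Type*} [Group G] (H : Subgroup G)
    (g : G) :
    Nat.card {x : G // x * g * x⁻¹ ∈ H} = Nat.card H * Nat.card {c : G ⧸ H // g • c = c} := by
  have h := QuotientGroup.card_preimage_mk H {c : G ⧸ H | g • c = c}
  refine Eq.trans (Nat.card_congr ((Equiv.inv G).subtypeEquiv fun x ↦ ?_)) h
  change x * g * x⁻¹ ∈ H ↔ ((g * x⁻¹ : G) : G ⧸ H) = (x⁻¹ : G)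
  rw [eq_comm, QuotientGroup.eq, inv_inv, mul_assoc]

/-- Let `G` be a finite group, `H` a subgroup of `G`, and `g ∈ G`.
Let `C(g) = {x g x⁻¹ : x ∈ G}` be the conjugacy class of `g` (elements conjugate to `g`).
Then the number of fixed points of `g` acting on the left coset space `G ⧸ H` satisfies
`|Fix(g)| * |C(g)| * |H| = |C(g) ∩ H| * |G|`. -/
theorem fixed_points_coset_action_card_mul
    {G : Type*} [Group G] [Fintype G] (H : Subgroup G) (g : G) :
    Nat.card {c : G ⧸ H // g • c = c} * Nat.card {x : G // IsConj g x} * Nat.card H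
      = Nat.card {x : G // IsConj g x ∧ x ∈ H} * Nat.card G := by
  have hC (x : G) : IsConj g x ↔ x ∈ MulAction.orbit (ConjAct G) g := by
    rw [ConjAct.mem_orbit_conjAct, isConj_comm]
  have hH := MulAction.card_smul_mem (G := ConjAct G) g (H : Set G)
  have hG := MulAction.card_smul_mem (G := ConjAct G) g Set.univ
  have hE : Nat.card {x : ConjAct G // x • g ∈ (H : Set G)} =
      Nat.card H * Nat.card {c : G ⧸ H // g • c = c} :=
    H.card_conj_mem_eq_card_mul_card_fixed g
  have hcard : Nat.card {x : ConjAct G // x • g ∈ Set.univ} = Nat.card G :=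
    Nat.card_congr (Equiv.Set.univ (ConjAct G))
  simp only [hC]
  simp only [SetLike.mem_coe, Set.mem_univ, and_true] at hH hG hE hcard
  rw [← hcard, hG, mul_right_comm, mul_comm (Nat.card {c : G ⧸ H // g • c = c}), ← hE, hH]
  ring
end

section
/- Let G be a finite group and H a subgroup of G. For every k ≥ 1, the number of orbits of the diagonal G-action on (G⧸H)^k equals (1/|G|) · Σ_{C ∈ ConjClasses(G)} |C| · (|C ∩ H| · |G| / (|C| · |H|))^k, where the sum runs over the conjugacy classes C of G and the identity is an equality of rational numbers. (In the paper this quantity is the dimension of the k-th space P_k of the planar algebra of the subgroup-subfactor R ⋊ H ⊂ R ⋊ G, i.e. of the relative commutant N' ∩ M_{k-1}.) -/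
open MulAction

theorem QuotientGroup.preimage_mk_fixedBy {G : Type*} [Group G] (H : Subgroup G) (g : G) :
    (QuotientGroup.mk ⁻¹' fixedBy (G ⧸ H) g : Set G) = {x | x⁻¹ * g * x ∈ H} := by
  ext x
  rw [Set.mem_preimage, mem_fixedBy, Set.mem_ofPred_eq, eq_comm, MulAction.Quotient.smul_coe,
    QuotientGroup.eq, smul_eq_mul, mul_assoc]

/-- Points fixed by `g` in a power are tuples of points fixed by `g`. -/
def MulAction.fixedByPiEquiv {G ι X : Type*} [Group G] [MulAction G X] (g : G) :
    fixedBy (ι → X) g ≃ (ι → fixedBy X g) where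
  toFun f i := ⟨f.1 i, congrFun f.2 i⟩
  invFun f := ⟨fun i => f i, funext fun i => (f i).2⟩

theorem IsConj.card_conj_mem_eq {G : Type*} [Group G] (H : Subgroup G) {g g' : G}
    (h : IsConj g g') :
    Nat.card {x : G | x⁻¹ * g * x ∈ H} = Nat.card {x : G | x⁻¹ * g' * x ∈ H} := by
  obtain ⟨c, rfl⟩ := isConj_iff.1 h
  refine Nat.card_congr ((Equiv.mulLeft c).subtypeEquiv fun x => ?_)
  simp [mul_assoc]

theorem ConjClasses.card_mul_card_conj_mem {G : Type*} [Group G] [Finite G] (H : Subgroup G)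
    (g : G) :
    Nat.card (ConjClasses.mk g).carrier * Nat.card {x : G | x⁻¹ * g * x ∈ H} =
      Nat.card G * Nat.card {x : G // x ∈ (ConjClasses.mk g).carrier ∧ x ∈ H} := by
  have e : (Σ a : (ConjClasses.mk g).carrier, {x : G | x⁻¹ * a * x ∈ H}) ≃
      G × {x : G // x ∈ (ConjClasses.mk g).carrier ∧ x ∈ H} :=
    { toFun := fun p => (p.2.1, ⟨p.2.1⁻¹ * p.1.1 * p.2.1, by
        refine ⟨?_, p.2.2⟩
        have h := p.1.2
        rw [mem_carrier_iff_mk_eq] at h ⊢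
        exact (mk_eq_mk_iff_isConj.2 (isConj_iff.2 ⟨p.2.1, by group⟩)).trans h⟩)
      invFun := fun p => ⟨⟨p.1 * p.2.1 * p.1⁻¹, by
        have h := p.2.2.1
        rw [mem_carrier_iff_mk_eq] at h ⊢
        exact (mk_eq_mk_iff_isConj.2 (isConj_iff.2 ⟨p.1, rfl⟩)).symm.trans h⟩, ⟨p.1, by simpa [mul_assoc] using p.2.2.2⟩⟩
      left_inv := by
        rintro ⟨⟨a, ha⟩, x, hx⟩
        refine Sigma.subtype_ext (Subtype.ext ?_) rfl
        simp [mul_assoc]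
      right_inv := by
        rintro ⟨x, a, ha⟩
        simp [mul_assoc] }
  have := Fintype.ofFinite (ConjClasses.mk g).carrier
  rw [← Nat.card_prod G, ← Nat.card_congr e, Nat.card_sigma, Finset.sum_congr rfl
    (g := fun _ => Nat.card {x : G | x⁻¹ * g * x ∈ H})]
  · simp
  · intro a _
    exact IsConj.card_conj_mem_eq H (mk_eq_mk_iff_isConj.1 (mem_carrier_iff_mk_eq.1 a.2))

/-- The permutation character of `G` on `G ⧸ H`. -/
theorem QuotientGroup.card_fixedBy_eq_div {G : Type*} [Group G] [Finite G] (H : Subgroup G)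
    (g : G) :
    (Nat.card (fixedBy (G ⧸ H) g) : ℚ) =
      ((Nat.card {x : G // x ∈ (ConjClasses.mk g).carrier ∧ x ∈ H} : ℚ) * (Nat.card G : ℚ)) /
        ((Nat.card (ConjClasses.mk g).carrier : ℚ) * (Nat.card H : ℚ)) := by
  have h := ConjClasses.card_mul_card_conj_mem H g
  rw [← preimage_mk_fixedBy, card_preimage_mk] at h
  have : Nonempty (ConjClasses.mk g).carrier := ⟨⟨g, ConjClasses.mem_carrier_mk⟩⟩
  have hC : (Nat.card (ConjClasses.mk g).carrier : ℚ) ≠ 0 := Nat.cast_ne_zero.2 Nat.card_pos.ne'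
  have hH : (Nat.card H : ℚ) ≠ 0 := Nat.cast_ne_zero.2 Nat.card_pos.ne'
  rw [eq_div_iff (mul_ne_zero hC hH)]
  have h' := congrArg (Nat.cast : ℕ → ℚ) h
  push_cast at h'
  linarith

theorem ConjClasses.sum_comp_mk {G M : Type*} [Group G] [Fintype G] [Fintype (ConjClasses G)]
    [Semiring M] (f : ConjClasses G → M) :
    ∑ g : G, f (ConjClasses.mk g) = ∑ C, (Nat.card C.carrier : M) * f C := by
  classical
  rw [← Finset.sum_fiberwise Finset.univ (ConjClasses.mk : G → ConjClasses G)]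
  refine Finset.sum_congr rfl fun C _ => ?_
  rw [Finset.sum_congr rfl (g := fun _ => f C) fun g hg => by rw [(Finset.mem_filter.1 hg).2],
    Finset.sum_const, nsmul_eq_mul, Nat.card_eq_fintype_card, ← Set.toFinset_card]
  congr 3
  ext g
  simp [mem_carrier_iff_mk_eq]


/-- Let `G` be a finite group and `H` a subgroup. For every `k ≥ 1`,
the number of orbits of the diagonal `G`-action on `(G⧸H)^k` equals
`(1/|G|) ⬝ ∑_{C ∈ ConjClasses G} |C| ⬝ (|C ∩ H| ⬝ |G| / (|C| ⬝ |H|))^k`,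
an equality of rational numbers.  (This is the dimension of the `k`-th space of the
planar algebra of the subgroup-subfactor `R ⋊ H ⊂ R ⋊ G`.) -/
theorem card_orbits_diagonal_action_eq_conjClasses_sum
    {G : Type*} [Group G] [Fintype G] (H : Subgroup G) (k : ℕ) (hk : 1 ≤ k) :
    (Nat.card (Quotient (MulAction.orbitRel G (Fin k → G ⧸ H))) : ℚ)
      = (1 / (Nat.card G : ℚ)) *
          ∑ᶠ C : ConjClasses G,
            (Nat.card C.carrier : ℚ) *
              (((Nat.card {x : G // x ∈ C.carrier ∧ x ∈ H} : ℚ) * (Nat.card G : ℚ)) /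
                ((Nat.card C.carrier : ℚ) * (Nat.card H : ℚ))) ^ k := by
  classical
  have := Fintype.ofFinite (ConjClasses G)
  have := Fintype.ofFinite (G ⧸ H)
  have := Fintype.ofFinite (Quotient (orbitRel G (Fin k → G ⧸ H)))
  have burnside := congrArg (Nat.cast : ℕ → ℚ)
    (sum_card_fixedBy_eq_card_orbits_mul_card_group G (Fin k → G ⧸ H))
  simp only [← Nat.card_eq_fintype_card, Nat.card_congr (fixedByPiEquiv _), Nat.card_fun,
    Nat.card_fin] at burnside
  push_cast [QuotientGroup.card_fixedBy_eq_div] at burnside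
  have hG : (Nat.card G : ℚ) ≠ 0 := Nat.cast_ne_zero.2 Nat.card_pos.ne'
  rw [finsum_eq_sum_of_fintype, ← ConjClasses.sum_comp_mk fun C =>
    (((Nat.card {x : G // x ∈ C.carrier ∧ x ∈ H} : ℚ) * (Nat.card G : ℚ)) /
      ((Nat.card C.carrier : ℚ) * (Nat.card H : ℚ))) ^ k, burnside]
  field_simp
end

section
/- Let G be a finite group, H a subgroup, H\G the set of right cosets, and σ : H\G → G a fixed section of the quotient map. For g ∈ G, let β^k_g : (H\G)^k → (H\G)^k be the map sending j to the unique i such that H·σ(j_l)σ(j_{l+1})⋯σ(j_k)·g⁻¹ = H·σ(i_l)σ(i_{l+1})⋯σ(i_k) for all 1 ≤ l ≤ k. Then β^k defines a left action of G on (H\G)^k: β^k_e is the identity map and β^k_{g g'} = β^k_g ∘ β^k_{g'} for all g, g' ∈ G. -/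
/-- The set `H\G` of right cosets of a subgroup `H` of `G`. -/
abbrev RightCoset (G : Type*) [Group G] (H : Subgroup G) :=
  Quotient (QuotientGroup.rightRel H)

/-- The right coset `H·x` of an element `x : G`. -/
def rcMk {G : Type*} [Group G] (H : Subgroup G) (x : G) : RightCoset G H :=
  Quotient.mk (QuotientGroup.rightRel H) x

/-- The partial product `σ(j_{l+1}) σ(j_{l+2}) ⋯ σ(j_k)` of section representatives
of the tail (all entries with 0-based index `≥ l`) of a `k`-tuple of right cosets. -/
def prodTail {G : Type*} [Group G] {H : Subgroup G} {k : ℕ}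
    (σ : RightCoset G H → G) (j : Fin k → RightCoset G H) (l : ℕ) : G :=
  ((List.ofFn fun m => σ (j m)).drop l).prod

theorem rcMk_mul_right_iff {G : Type*} [Group G] (H : Subgroup G) (x y t : G) :
    rcMk H (x * t) = rcMk H (y * t) ↔ rcMk H x = rcMk H y := by
  simp only [rcMk, Quotient.eq, QuotientGroup.rightRel_apply, mul_inv_rev, mul_assoc,
    mul_inv_cancel_left]

theorem prodTail_eq_mul {G : Type*} [Group G] {H : Subgroup G} {k : ℕ}
    (σ : RightCoset G H → G) (j : Fin k → RightCoset G H) (l : Fin k) :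
    prodTail σ j l = σ (j l) * prodTail σ j (l + 1) := by
  unfold prodTail
  rw [List.drop_eq_getElem_cons (by simp), List.prod_cons]
  simp

theorem prodTail_of_le {G : Type*} [Group G] {H : Subgroup G} {k : ℕ}
    (σ : RightCoset G H → G) (j : Fin k → RightCoset G H) {l : ℕ} (hl : k ≤ l) :
    prodTail σ j l = 1 := by
  simp [prodTail, List.drop_eq_nil_of_le, hl]

/-- A tuple of right cosets is determined by the cosets of its tail products. -/
theorem eq_of_rcMk_prodTail_eq {G : Type*} [Group G] {H : Subgroup G}
    {σ : RightCoset G H → G} (hσ : ∀ c, rcMk H (σ c) = c) {k : ℕ}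
    {i j : Fin k → RightCoset G H}
    (h : ∀ l : Fin k, rcMk H (prodTail σ i l) = rcMk H (prodTail σ j l)) : i = j := by
  have entry_eq (l : Fin k) (ht : prodTail σ i (l + 1) = prodTail σ j (l + 1)) :
      i l = j l := by
    have hl := h l
    rwa [prodTail_eq_mul, prodTail_eq_mul, ht, rcMk_mul_right_iff, hσ, hσ] at hl
  have tail_eq (l : ℕ) (hl : l ≤ k) : prodTail σ i l = prodTail σ j l := by
    induction hl using Nat.decreasingInduction with
    | self => rw [prodTail_of_le σ i le_rfl, prodTail_of_le σ j le_rfl]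
    | of_succ l hl ih =>
      have hi := prodTail_eq_mul σ i ⟨l, hl⟩
      have hj := prodTail_eq_mul σ j ⟨l, hl⟩
      rw [hi, hj, entry_eq ⟨l, hl⟩ ih, ih]
  exact funext fun l => entry_eq l (tail_eq (l + 1) l.isLt)

/-- Let `G` be a finite group, `H` a subgroup, `σ : H\G → G` a section of the
quotient map, and for `g ∈ G` let `β^k_g : (H\G)^k → (H\G)^k` be the map sending `j` to the
unique `i` with `H·σ(j_l)⋯σ(j_k)·g⁻¹ = H·σ(i_l)⋯σ(i_k)` for all `l`.  Then `β^k` is a left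
action of `G` on `(H\G)^k`: `β^k_e = id` and `β^k_{g g'} = β^k_g ∘ β^k_{g'}`. -/
theorem beta_one_and_beta_mul
    {G : Type*} [Group G] [Finite G] (H : Subgroup G)
    (σ : RightCoset G H → G) (hσ : ∀ c, rcMk H (σ c) = c) (k : ℕ)
    (β : G → (Fin k → RightCoset G H) → (Fin k → RightCoset G H))
    (hβ : ∀ (g : G) (j : Fin k → RightCoset G H) (l : Fin k),
      rcMk H (prodTail σ j l * g⁻¹) = rcMk H (prodTail σ (β g j) l)) :
    (∀ j : Fin k → RightCoset G H, β 1 j = j)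
      ∧ ∀ (g g' : G) (j : Fin k → RightCoset G H), β (g * g') j = β g (β g' j) := by
  refine ⟨fun j => eq_of_rcMk_prodTail_eq hσ fun l => ?_,
    fun g g' j => eq_of_rcMk_prodTail_eq hσ fun l => ?_⟩
  · rw [← hβ, inv_one, mul_one]
  · rw [← hβ, ← hβ, mul_inv_rev, ← mul_assoc, rcMk_mul_right_iff, hβ]
end

section
/- Let G be a finite group, H a subgroup, H\G the set of right cosets, and σ : H\G → G a fixed section of the quotient map. For k ≥ 1, let Y_k = {(i, j) ∈ (H\G)^k × (H\G)^k : H·σ(i₁)⋯σ(i_k) = H·σ(j₁)⋯σ(j_k)}. Then the map Y_k → (H\G)^{2k−1} sending (i, j) to the (2k−1)-tuple (H·σ(i_k), H·σ(i_{k−1})σ(i_k), …, H·σ(i₁)σ(i₂)⋯σ(i_k), H·σ(j_k), H·σ(j_{k−1})σ(j_k), …, H·σ(j₂)σ(j₃)⋯σ(j_k)) is a bijection. -/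
theorem rcMk_section_mul_injective {G : Type*} [Group G] {H : Subgroup G}
    {σ : RightCoset G H → G} (hσ : ∀ c, rcMk H (σ c) = c) (g : G) :
    Function.Injective fun c => rcMk H (σ c * g) := by
  intro a b h
  rw [← hσ a, ← hσ b]
  refine Quotient.sound ?_
  have h' := Quotient.exact h
  rw [← Quotient.eq_iff_equiv, Quotient.eq, QuotientGroup.rightRel_apply] at h' ⊢
  simpa [mul_assoc] using h'

theorem prodTail_zero {G : Type*} [Group G] {H : Subgroup G} {k : ℕ}
    (σ : RightCoset G H → G) (j : Fin (k + 1) → RightCoset G H) :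
    prodTail σ j 0 = σ (j 0) * prodTail σ (Fin.tail j) 0 := by
  simp [prodTail, Fin.tail, List.ofFn_succ]

theorem prodTail_succ {G : Type*} [Group G] {H : Subgroup G} {k : ℕ}
    (σ : RightCoset G H → G) (j : Fin (k + 1) → RightCoset G H) (l : ℕ) :
    prodTail σ j (l + 1) = prodTail σ (Fin.tail j) l := by
  simp [prodTail, Fin.tail, List.ofFn_succ]

/-- A tuple of right cosets is determined by the cosets of its tail products. -/
theorem rcMk_prodTail_injective {G : Type*} [Group G] {H : Subgroup G}
    {σ : RightCoset G H → G} (hσ : ∀ c, rcMk H (σ c) = c) (k : ℕ) :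
    Function.Injective
      fun (j : Fin k → RightCoset G H) (l : Fin k) => rcMk H (prodTail σ j l) := by
  induction k with
  | zero => exact Function.injective_of_subsingleton _
  | succ k ih =>
    intro i j h
    have ht : Fin.tail i = Fin.tail j := by
      refine ih (funext fun l => ?_)
      simpa [prodTail_succ] using congrFun h l.succ
    have h₀ : i 0 = j 0 := by
      refine rcMk_section_mul_injective hσ (prodTail σ (Fin.tail j) 0) ?_
      simpa [prodTail_zero, ht] using congrFun h 0
    rw [← Fin.cons_self_tail i, ← Fin.cons_self_tail j, h₀, ht]

theorem rcMk_prodTail_surjective {G : Type*} [Group G] [Finite G] {H : Subgroup G}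
    {σ : RightCoset G H → G} (hσ : ∀ c, rcMk H (σ c) = c) (k : ℕ) :
    Function.Surjective
      fun (j : Fin k → RightCoset G H) (l : Fin k) => rcMk H (prodTail σ j l) :=
  Finite.surjective_of_injective (rcMk_prodTail_injective hσ k)

/-- Let `G` be a finite group, `H` a subgroup, `σ : H\G → G` a section of
the quotient map, and for `k ≥ 1` let
`Y_k = {(i,j) : H·σ(i₁)⋯σ(i_k) = H·σ(j₁)⋯σ(j_k)}`.  The map sending `(i,j) ∈ Y_k` to the
`(2k-1)`-tuple `(H·σ(i_k), H·σ(i_{k-1})σ(i_k), …, H·σ(i₁)⋯σ(i_k),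
H·σ(j_k), H·σ(j_{k-1})σ(j_k), …, H·σ(j₂)⋯σ(j_k))` is a bijection `Y_k → (H\G)^(2k-1)`. -/
theorem Yk_equiv_tuples
    {G : Type*} [Group G] [Finite G] (H : Subgroup G)
    (σ : RightCoset G H → G) (hσ : ∀ c, rcMk H (σ c) = c)
    (k : ℕ) (hk : 1 ≤ k) :
    Function.Bijective
      (fun (p : {p : (Fin k → RightCoset G H) × (Fin k → RightCoset G H) //
            rcMk H (prodTail σ p.1 0) = rcMk H (prodTail σ p.2 0)})
          (m : Fin (2 * k - 1)) =>
        if (m : ℕ) < k then rcMk H (prodTail σ p.1.1 (k - 1 - (m : ℕ)))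
        else rcMk H (prodTail σ p.1.2 (2 * k - 1 - (m : ℕ)))) := by
  constructor
  · rintro ⟨⟨i, j⟩, hp⟩ ⟨⟨i', j'⟩, hq⟩ h
    have hi : ∀ l < k, rcMk H (prodTail σ i l) = rcMk H (prodTail σ i' l) := by
      intro l hl
      have hm := congrFun h ⟨k - 1 - l, by omega⟩
      have hlt : k - 1 - l < k := by omega
      have hsub : k - 1 - (k - 1 - l) = l := by omega
      simpa only [hlt, if_true, hsub] using hm
    have hj : ∀ l < k, rcMk H (prodTail σ j l) = rcMk H (prodTail σ j' l) := by
      intro l hl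
      rcases Nat.eq_zero_or_pos l with rfl | hpos
      · exact hp.symm.trans ((hi 0 hl).trans hq)
      · have hm := congrFun h ⟨2 * k - 1 - l, by omega⟩
        have hlt : ¬ 2 * k - 1 - l < k := by omega
        have hsub : 2 * k - 1 - (2 * k - 1 - l) = l := by omega
        simpa only [hlt, if_false, hsub] using hm
    have hi' : i = i' := rcMk_prodTail_injective hσ k (funext fun l => hi l l.2)
    have hj' : j = j' := rcMk_prodTail_injective hσ k (funext fun l => hj l l.2)
    subst hi' hj'
    rfl
  · intro t
    obtain ⟨i, hi⟩ := rcMk_prodTail_surjective hσ k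
      fun l => t ⟨k - 1 - l, by omega⟩
    obtain ⟨j, hj⟩ := rcMk_prodTail_surjective hσ k
      fun l => if h : (l : ℕ) = 0 then t ⟨k - 1, by omega⟩ else t ⟨2 * k - 1 - l, by omega⟩
    refine ⟨⟨⟨i, j⟩, ?_⟩, funext fun m => ?_⟩
    · have hi₀ := congrFun hi ⟨0, hk⟩
      have hj₀ := congrFun hj ⟨0, hk⟩
      exact hi₀.trans hj₀.symm
    · have hm := m.2
      dsimp only
      split_ifs with hlt
      · refine (congrFun hi ⟨k - 1 - m, by omega⟩).trans (congrArg t (Fin.ext ?_))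
        dsimp only
        omega
      · have hne : 2 * k - 1 - (m : ℕ) ≠ 0 := by omega
        refine (congrFun hj ⟨2 * k - 1 - m, by omega⟩).trans ?_
        dsimp only
        rw [dif_neg hne]
        refine congrArg t (Fin.ext ?_)
        dsimp only
        omega
end
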